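/- arXiv:0802.3820 — 2 statements merged into one kernel-verified Lean document; each statement's English description precedes it below -/
import Mathlib

section
/- Let G be a finite connected simple graph in which every vertex has at least two neighbors and which contains no θ-subgraph. Then G contains a 'hanging' cycle: there exist a cycle C in G and a vertex v of C such that every edge of G joining a vertex of C to a vertex not in C has its endpoint on C equal to v. -/
open SimpleGraph

/-- `G` has a θ-subgraph: two distinct vertices `u, v` joined by three distinct paths
which pairwise have no common vertices other than `u` and `v`. -/
def HasTheta {V : Type*} (G : SimpleGraph V) : Prop :=
  ∃ (u v : V) (p q r : G.Walk u v),
    u ≠ v ∧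
    p.IsPath ∧ q.IsPath ∧ r.IsPath ∧
    p ≠ q ∧ p ≠ r ∧ q ≠ r ∧
    (∀ w, w ∈ p.support → w ∈ q.support → w = u ∨ w = v) ∧
    (∀ w, w ∈ p.support → w ∈ r.support → w = u ∨ w = v) ∧
    (∀ w, w ∈ q.support → w ∈ r.support → w = u ∨ w = v)

/-- A walk ending in `S` can be shortened to a path which meets `S` only at its end. -/
lemma exists_isPath_first_hit {V : Type*} {G : SimpleGraph V} (S : Set V) {y a : V}
    (p : G.Walk y a) (ha : a ∈ S) :
    ∃ (z : V) (q : G.Walk y z), q.IsPath ∧ z ∈ S ∧ (∀ w ∈ q.support, w ∈ p.support) ∧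
      ∀ w ∈ q.support, w ∈ S → w = z := by
  classical
  suffices h : ∃ (z : V) (q : G.Walk y z), z ∈ S ∧ (∀ w ∈ q.support, w ∈ p.support) ∧
      ∀ w ∈ q.support, w ∈ S → w = z by
    obtain ⟨z, q, hz, hq, hS⟩ := h
    exact ⟨z, q.bypass, q.bypass_isPath, hz,
      fun w hw => hq w (q.support_bypass_subset_support hw),
      fun w hw => hS w (q.support_bypass_subset_support hw)⟩
  induction p with
  | nil => exact ⟨_, Walk.nil, ha, by simp, by simp⟩
  | @cons u v w h p ih =>
    by_cases hu : u ∈ S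
    · exact ⟨u, Walk.nil, hu, by simp, by simp⟩
    · obtain ⟨z, q, hz, hq, hS⟩ := ih ha
      refine ⟨z, Walk.cons h q, hz, ?_, ?_⟩
      · intro x hx
        rw [Walk.support_cons, List.mem_cons] at hx ⊢
        exact hx.imp_right (hq x)
      · intro x hx hxS
        rw [Walk.support_cons, List.mem_cons] at hx
        rcases hx with rfl | hx
        · exact absurd hxS hu
        · exact hS x hx hxS

/-- If `a` is the only outside neighbor of `K`, a path from `K` to `a` stays in `K ∪ {a}`. -/
lemma SimpleGraph.Walk.IsPath.support_subset_insert {V : Type*} {G : SimpleGraph V} {K : Set V}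
    {c a : V} (hK : ∀ x ∈ K, ∀ y, G.Adj x y → y ∈ K ∨ y = a) {p : G.Walk c a} (hp : p.IsPath)
    (hc : c ∈ K) : ∀ w ∈ p.support, w ∈ K ∨ w = a := by
  induction p with
  | nil => simp
  | @cons u v a h p ih =>
    intro w hw
    rw [Walk.support_cons, List.mem_cons] at hw
    rcases hw with rfl | hw
    · exact Or.inl hc
    rcases hK _ hc _ h with hv | rfl
    · exact ih hK hp.of_cons hv w hw
    · rw [(Walk.isPath_iff_nil.mp hp.of_cons).eq_nil] at hw
      exact Or.inr (by simpa using hw)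

/-- A cycle together with an ear attached at two distinct vertices `x` and `z` forms a
θ-subgraph. -/
lemma SimpleGraph.Walk.IsCycle.hasTheta {V : Type*} {G : SimpleGraph V} {x y z : V}
    {c : G.Walk x x} (hc : c.IsCycle) (hxy : G.Adj x y) {q : G.Walk y z} (hq : q.IsPath)
    (hx : x ∉ q.support) (hy : y ∉ c.support) (hz : z ∈ c.support)
    (hqc : ∀ w ∈ q.support, w ∈ c.support → w = z) : HasTheta G := by
  classical
  have hxz : x ≠ z := by
    rintro rfl
    exact hx q.end_mem_support
  cases c with
  | nil => exact absurd hc Walk.not_isCycle_nil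
  | @cons _ v _ h p =>
    rw [Walk.cons_isCycle_iff] at hc
    obtain ⟨hp, he⟩ := hc
    have hzp : z ∈ p.support := by
      rw [Walk.support_cons, List.mem_cons] at hz
      exact hz.resolve_left hxz.symm
    have hcp : ∀ w ∈ p.support, w ∈ (Walk.cons h p).support := fun w hw => by
      rw [Walk.support_cons]
      exact List.mem_cons_of_mem _ hw
    have hdisj : ∀ w ∈ (p.takeUntil z hzp).support, w ∈ (p.dropUntil z hzp).support → w = z := by
      intro w h₁ h₂
      have hnd := hp.support_nodup
      rw [← p.take_spec hzp, Walk.support_append, List.nodup_append] at hnd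
      rw [← Walk.cons_tail_support, List.mem_cons] at h₂
      exact h₂.resolve_right fun h₃ => hnd.2.2 w h₁ w h₃ rfl
    have hxt : x ∉ (p.takeUntil z hzp).support := fun h₁ =>
      hxz (hdisj x h₁ (Walk.end_mem_support _))
    have hr : ∀ w ∈ (Walk.cons hxy q).support, w ∈ (Walk.cons h p).support → w = x ∨ w = z := by
      intro w h₁ h₂
      rw [Walk.support_cons, List.mem_cons] at h₁
      exact h₁.imp_right fun h₃ => hqc w h₃ h₂
    have hP : ∀ w ∈ (Walk.cons h (p.takeUntil z hzp)).support, w ∈ (Walk.cons h p).support := by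
      intro w hw
      rw [Walk.support_cons, List.mem_cons] at hw ⊢
      exact hw.imp_right fun h₁ => p.support_takeUntil_subset_support hzp h₁
    have hQ : ∀ w ∈ (p.dropUntil z hzp).reverse.support, w ∈ (Walk.cons h p).support := by
      intro w hw
      rw [Walk.support_reverse, List.mem_reverse] at hw
      exact hcp w (p.support_dropUntil_subset_support hzp hw)
    have hyr : y ∈ (Walk.cons hxy q).support := by simp
    refine ⟨x, z, Walk.cons h (p.takeUntil z hzp), (p.dropUntil z hzp).reverse,
      Walk.cons hxy q, hxz, (hp.takeUntil hzp).cons hxt, (hp.dropUntil hzp).reverse,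
      hq.cons hx, ?_, ?_, ?_, ?_, fun w h₁ h₂ => hr w h₂ (hP w h₁),
      fun w h₁ h₂ => hr w h₂ (hQ w h₁)⟩
    · intro heq
      have h₁ : s(x, v) ∈ (Walk.cons h (p.takeUntil z hzp)).edges := by simp
      rw [heq, Walk.edges_reverse, List.mem_reverse] at h₁
      exact he (p.edges_dropUntil_subset_edges hzp h₁)
    · intro heq
      exact hy (hP y (heq ▸ hyr))
    · intro heq
      exact hy (hQ y (heq ▸ hyr))
    · intro w h₁ h₂
      rw [Walk.support_cons, List.mem_cons] at h₁
      rw [Walk.support_reverse, List.mem_reverse] at h₂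
      exact h₁.imp_right fun h₃ => hdisj w h₃ h₂

/-- A smallest nonempty vertex set `K` whose only possible outside neighbor is one vertex `a`
cannot be separated from `a` by deleting a vertex of `K`. -/
lemma exists_minimal_fragment {V : Type*} [Finite V] [Nontrivial V] (G : SimpleGraph V) :
    ∃ (K : Set V) (a : V), K.Nonempty ∧ a ∉ K ∧ (∀ x ∈ K, ∀ y, G.Adj x y → y ∈ K ∨ y = a) ∧
      ∀ x ∈ K, ∀ y ∈ K, y ≠ x → ∃ p : G.Walk y a, x ∉ p.support := by
  let F : Set (Set V) := {K | K.Nonempty ∧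
    ∃ a, a ∉ K ∧ ∀ x ∈ K, ∀ y, G.Adj x y → y ∈ K ∨ y = a}
  have hF : F.Nonempty := by
    obtain ⟨a, b, hab⟩ := exists_pair_ne V
    refine ⟨{a}ᶜ, ⟨b, hab.symm⟩, a, by simp, fun x _ y _ => ?_⟩
    simpa using (em (y = a)).symm
  obtain ⟨K, hmin⟩ := F.toFinite.exists_minimal hF
  obtain ⟨hne, a, ha, hK⟩ := hmin.prop
  refine ⟨K, a, hne, ha, hK, fun x hx y hy hyx => ?_⟩
  by_contra! hcon
  let K' : Set V := {w | w ∈ K ∧ w ≠ x ∧ ∀ p : G.Walk w a, x ∈ p.support}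
  have hK' : K' ∈ F := by
    refine ⟨⟨y, hy, hyx, hcon⟩, x, fun h => h.2.1 rfl, ?_⟩
    rintro w ⟨hw, hwx, hwp⟩ v hwv
    have hxv : ∀ p : G.Walk v a, x ∈ p.support := fun p => by
      have h := hwp (Walk.cons hwv p)
      rw [Walk.support_cons, List.mem_cons] at h
      exact h.resolve_left hwx.symm
    rcases hK w hw v hwv with hv | rfl
    · by_cases hvx : v = x
      · exact Or.inr hvx
      · exact Or.inl ⟨hv, hvx, hxv⟩
    · exact Or.inr (List.mem_singleton.mp (hxv Walk.nil)).symm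
  exact (hmin.le_of_le hK' (fun w hw => hw.1) hx).2.1 rfl

/-- Let `G` be a finite connected simple graph in which every vertex has at least two
neighbors and which contains no θ-subgraph.  Then `G` contains a 'hanging' cycle:
a cycle `C` together with a vertex `v` of `C` such that every edge of `G` joining a
vertex of `C` to a vertex not in `C` has its endpoint on `C` equal to `v`. -/
theorem stmt_5 {V : Type*} [Fintype V] (G : SimpleGraph V)
    (hconn : G.Connected)
    (hdeg : ∀ v : V, 2 ≤ (G.neighborSet v).ncard)
    (htheta : ¬ HasTheta G) :
    ∃ (v : V) (c : G.Walk v v), c.IsCycle ∧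
      ∀ a b : V, G.Adj a b → a ∈ c.support → b ∉ c.support → a = v := by
  classical
  have hnbr : ∀ v u : V, ∃ w, G.Adj v w ∧ w ≠ u := fun v u => by
    obtain ⟨w, hw, hwu⟩ := Set.exists_ne_of_one_lt_ncard (hdeg v) u
    exact ⟨w, hw, hwu⟩
  have : Nontrivial V := by
    obtain ⟨v⟩ := hconn.nonempty
    obtain ⟨w, hw, -⟩ := hnbr v v
    exact ⟨v, w, hw.ne⟩
  obtain ⟨K, a, ⟨k, hk⟩, ha, hK, hsep⟩ := exists_minimal_fragment G
  obtain ⟨b, hb, hba⟩ : ∃ b ∈ K, G.Adj b a := by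
    obtain ⟨p⟩ := hconn.preconnected k a
    obtain ⟨d, -, h₁, h₂⟩ := p.exists_boundary_dart K hk ha
    exact ⟨d.fst, h₁, (hK _ h₁ _ d.adj).resolve_left h₂ ▸ d.adj⟩
  obtain ⟨c, hbc, hca⟩ := hnbr b a
  have hc : c ∈ K := (hK b hb c hbc).resolve_right hca
  obtain ⟨p, hbp⟩ := hsep b hb c hc hbc.ne'
  have hbp' : b ∉ p.bypass.support := fun h => hbp (p.support_bypass_subset_support h)
  have hpath : (Walk.cons hbc p.bypass).IsPath := p.bypass_isPath.cons hbp'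
  have hcyc : (Walk.cons hba.symm (Walk.cons hbc p.bypass)).IsCycle := by
    rw [Walk.cons_isCycle_iff]
    refine ⟨hpath, fun h => ?_⟩
    rw [Walk.edges_cons, List.mem_cons] at h
    rcases h with h | h
    · rw [Sym2.eq_swap, Sym2.congr_right] at h
      exact hca h.symm
    · exact hbp' (Walk.snd_mem_support_of_mem_edges _ h)
  refine ⟨a, _, hcyc, fun x y hxy hx hy => ?_⟩
  by_contra hxa
  have hxK : x ∈ K := by
    rw [Walk.support_cons, List.mem_cons] at hx
    exact (hpath.support_subset_insert hK hb x (hx.resolve_left hxa)).resolve_right hxa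
  have hyK : y ∈ K := by
    refine (hK x hxK y hxy).resolve_right fun h => ?_
    rw [h] at hy
    exact hy (Walk.start_mem_support _)
  obtain ⟨r, hxr⟩ := hsep x hxK y hyK hxy.ne'
  obtain ⟨z, q, hq, hz, hqr, hqS⟩ := exists_isPath_first_hit
    {w | w ∈ (Walk.cons hba.symm (Walk.cons hbc p.bypass)).support} r (Walk.start_mem_support _)
  refine htheta ((hcyc.rotate hx).hasTheta hxy hq (fun h => hxr (hqr x h)) ?_ ?_ ?_)
  · rwa [Walk.mem_support_rotate_iff]
  · rwa [Walk.mem_support_rotate_iff]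
  · intro w h₁ h₂
    rw [Walk.mem_support_rotate_iff] at h₂
    exact hqS w h₁ h₂
end

section
/- Let G be a finite simple graph containing a cycle C, let p and q be two distinct vertices of C, and let x and y be two adjacent vertices of G not lying on C. Suppose that p is adjacent to x or to y, and q is adjacent to x or to y. Then G contains a θ-subgraph. -/
open SimpleGraph

/-- Two distinct vertices of a cycle are joined by two internally disjoint paths
running along the cycle. -/
theorem SimpleGraph.Walk.IsCycle.exists_two_paths {V : Type*} {G : SimpleGraph V}
    {w : V} {c : G.Walk w w} (hc : c.IsCycle)
    {p q : V} (hp : p ∈ c.support) (hq : q ∈ c.support) (hpq : p ≠ q) :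
    ∃ a b : G.Walk p q, a.IsPath ∧ b.IsPath ∧ a ≠ b ∧
      (∀ z, z ∈ a.support → z ∈ b.support → z = p ∨ z = q) ∧
      (∀ z ∈ a.support, z ∈ c.support) ∧ (∀ z ∈ b.support, z ∈ c.support) := by
  classical
  have hr : (c.rotate p hp).IsCycle := hc.rotate hp
  have hmem : ∀ z, z ∈ (c.rotate p hp).support ↔ z ∈ c.support := fun z => by
    rw [Walk.mem_support_rotate_iff]
  generalize c.rotate p hp = d at hr hmem
  have hqd : q ∈ d.support := (hmem q).2 hq
  obtain ⟨a, b, rfl⟩ := Walk.mem_support_iff_exists_append.1 hqd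
  have hnodup := hr.support_nodup
  have hedges := hr.edges_nodup
  rw [Walk.tail_support_append, List.nodup_append'] at hnodup
  rw [Walk.edges_append, List.nodup_append'] at hedges
  obtain ⟨ha, hb, hab⟩ := hnodup
  have hqa : q ∈ a.support.tail :=
    ((Walk.mem_support_iff a).1 a.end_mem_support).resolve_left hpq.symm
  have hpb : p ∈ b.support.tail :=
    ((Walk.mem_support_iff b).1 b.end_mem_support).resolve_left hpq
  refine ⟨a, b.reverse, ?_, ?_, ?_, ?_, ?_, ?_⟩
  · rw [Walk.isPath_def, ← Walk.cons_tail_support, List.nodup_cons]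
    exact ⟨fun h => hab h hpb, ha⟩
  · rw [Walk.isPath_reverse_iff, Walk.isPath_def, ← Walk.cons_tail_support, List.nodup_cons]
    exact ⟨fun h => hab hqa h, hb⟩
  · rintro rfl
    cases b with
    | nil => exact hpq rfl
    | cons h t => simp at hedges
  · intro z hza hzb
    rw [Walk.support_reverse, List.mem_reverse] at hzb
    rcases (Walk.mem_support_iff a).1 hza with h | h
    · exact Or.inl h
    rcases (Walk.mem_support_iff b).1 hzb with h' | h'
    · exact Or.inr h'
    · exact (hab h h').elim
  · intro z hz
    exact (hmem z).1 ((Walk.mem_support_append_iff _ _).2 (Or.inl hz))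
  · intro z hz
    rw [Walk.support_reverse, List.mem_reverse] at hz
    exact (hmem z).1 ((Walk.mem_support_append_iff _ _).2 (Or.inr hz))

/-- A cycle together with a path that joins two of its vertices, passes through a vertex off
the cycle, and meets the cycle only in its ends, gives a θ-subgraph. -/
theorem SimpleGraph.Walk.IsCycle.hasTheta_of_ear {V : Type*} {G : SimpleGraph V}
    {w : V} {c : G.Walk w w} (hc : c.IsCycle)
    {p q : V} (hp : p ∈ c.support) (hq : q ∈ c.support) (hpq : p ≠ q)
    (r : G.Walk p q) (hr : r.IsPath) (hr_off : ∃ z ∈ r.support, z ∉ c.support)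
    (hrc : ∀ z ∈ r.support, z ∈ c.support → z = p ∨ z = q) : HasTheta G := by
  obtain ⟨a, b, ha, hb, hab, hdisj, hac, hbc⟩ := hc.exists_two_paths hp hq hpq
  obtain ⟨z, hzr, hzc⟩ := hr_off
  refine ⟨p, q, a, b, r, hpq, ha, hb, hr, hab, ?_, ?_, hdisj,
    fun v hv hvr => hrc v hvr (hac v hv), fun v hv hvr => hrc v hvr (hbc v hv)⟩
  · rintro rfl
    exact hzc (hac z hzr)
  · rintro rfl
    exact hzc (hbc z hzr)

/-- Let `G` be a finite simple graph containing a cycle `C`, let `p, q` be two distinct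
vertices of `C`, and let `x, y` be two adjacent vertices of `G` not lying on `C`.
If `p` is adjacent to `x` or to `y`, and `q` is adjacent to `x` or to `y`, then `G`
contains a θ-subgraph. -/
theorem stmt_7 {V : Type*} [Fintype V] (G : SimpleGraph V)
    {w : V} (c : G.Walk w w) (hc : c.IsCycle)
    {p q : V} (hp : p ∈ c.support) (hq : q ∈ c.support) (hpq : p ≠ q)
    {x y : V} (hxy : G.Adj x y) (hx : x ∉ c.support) (hy : y ∉ c.support)
    (hpx : G.Adj p x ∨ G.Adj p y) (hqx : G.Adj q x ∨ G.Adj q y) :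
    HasTheta G := by
  have ne_of_mem {u v : V} (hu : u ∈ c.support) (hv : v ∉ c.support) : u ≠ v :=
    fun h => hv (h ▸ hu)
  have short {z : V} (hz : z ∉ c.support) (hpz : G.Adj p z) (hqz : G.Adj q z) :
      HasTheta G := by
    refine hc.hasTheta_of_ear hp hq hpq (.cons hpz (.cons hqz.symm .nil)) ?_ ⟨z, by simp, hz⟩ ?_
    · simp [Walk.isPath_def, hpq, ne_of_mem hp hz, (ne_of_mem hq hz).symm]
    · simp [hz]
  have long {s t : V} (hst : G.Adj s t) (hs : s ∉ c.support) (ht : t ∉ c.support)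
      (hps : G.Adj p s) (hqt : G.Adj q t) : HasTheta G := by
    refine hc.hasTheta_of_ear hp hq hpq (.cons hps (.cons hst (.cons hqt.symm .nil))) ?_
      ⟨s, by simp, hs⟩ ?_
    · simp [Walk.isPath_def, hpq, ne_of_mem hp hs, ne_of_mem hp ht, hst.ne,
        (ne_of_mem hq hs).symm, (ne_of_mem hq ht).symm]
    · simp [hs, ht]
  rcases hpx with hpx | hpy <;> rcases hqx with hqx | hqy
  · exact short hx hpx hqx
  · exact long hxy hx hy hpx hqy
  · exact long hxy.symm hy hx hpy hqx
  · exact short hy hpy hqy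
end
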